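/- Suppose there exist a locally Lipschitz function V : [0,∞)×ℝⁿ → [0,∞), functions a₁, a₂ ∈ K∞, μ ∈ K⁺ and a continuous positive definite ρ : [0,∞) → [0,∞) such that a₁(|(μ(t)x, H(t,x))|) ≤ V(t,x) ≤ a₂(|x|) for all (t,x) ∈ [0,∞)×ℝⁿ (here |(μ(t)x, H(t,x))| is the Euclidean norm of the pair in ℝⁿ⁺ᵏ), and V⁰(t, x; f(t,d,x)) ≤ −ρ(V(t,x)) for all (t,x,d) ∈ [0,∞)×ℝⁿ×D. Then system (2.1) is URGAOS. -/

import Mathlib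

open Filter Topology MeasureTheory Set

noncomputable section

/-- ℝⁿ with the Euclidean norm. -/
abbrev Euc (n : ℕ) := EuclideanSpace ℝ (Fin n)

/-- The Dini derivative V⁰(t,x;v) := limsup_{h→0⁺, w→v} (V(t+h, x+h·w) − V(t,x))/h,
with values in the extended reals. -/
def dini0 {n : ℕ} (V : ℝ → Euc n → ℝ) (t : ℝ) (x v : Euc n) : EReal :=
  Filter.limsup
    (fun p : ℝ × Euc n => (((V (t + p.1) (x + p.1 • p.2) - V t x) / p.1 : ℝ) : EReal))
    ((𝓝[>] (0:ℝ)) ×ˢ 𝓝 v)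

/-- Class K∞ functions (on [0,∞)). -/
def IsKinf (a : ℝ → ℝ) : Prop :=
  ContinuousOn a (Ici 0) ∧ StrictMonoOn a (Ici 0) ∧ a 0 = 0 ∧ Tendsto a atTop atTop

/-- Class K⁺: positive continuous functions on [0,∞). -/
def IsKplus (b : ℝ → ℝ) : Prop := ContinuousOn b (Ici 0) ∧ ∀ t, 0 ≤ t → 0 < b t

/-- Class ℰ: continuous nonnegative integrable functions on [0,∞) tending to 0. -/
def IsClassE (q : ℝ → ℝ) : Prop :=
  ContinuousOn q (Ici 0) ∧ (∀ t, 0 ≤ t → 0 ≤ q t) ∧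
    IntegrableOn q (Ici 0) ∧ Tendsto q atTop (𝓝 0)

/-- Continuous positive definite functions on [0,∞). -/
def IsPosDef (ρ : ℝ → ℝ) : Prop :=
  ContinuousOn ρ (Ici 0) ∧ ρ 0 = 0 ∧ (∀ s, 0 < s → 0 < ρ s) ∧ ∀ s, 0 ≤ s → 0 ≤ ρ s

/-- Membership in M_D : measurable selections of values in D. -/
def InMD {l : ℕ} (D : Set (Euc l)) (d : ℝ → Euc l) : Prop :=
  Measurable d ∧ ∀ t, d t ∈ D

/-- Euclidean norm of the pair (a,b) ∈ ℝⁿ⁺ᵏ. -/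
def pairNorm {n k : ℕ} (a : Euc n) (b : Euc k) : ℝ := Real.sqrt (‖a‖ ^ 2 + ‖b‖ ^ 2)

/-- x : [t₀, tmax) → ℝⁿ is the (absolutely continuous) solution of ẋ = F(t,d(t),x) with
x(t₀) = x₀, expressed in integral form. -/
def IsSolution {n l : ℕ} (F : ℝ → Euc l → Euc n → Euc n) (d : ℝ → Euc l)
    (t₀ : ℝ) (x₀ : Euc n) (tmax : EReal) (x : ℝ → Euc n) : Prop :=
  (t₀ : EReal) < tmax ∧ x t₀ = x₀ ∧
    ContinuousOn x {t : ℝ | t₀ ≤ t ∧ (t : EReal) < tmax} ∧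
    ∀ t : ℝ, t₀ ≤ t → (t : EReal) < tmax → x t = x₀ + ∫ s in t₀..t, F s (d s) (x s)


lemma rhs_meas {n l : ℕ} {D : Set (Euc l)} (hD : IsCompact D)
    {f : ℝ → Euc l → Euc n → Euc n}
    (hf_cont : ContinuousOn (fun p : ℝ × Euc l × Euc n => f p.1 p.2.1 p.2.2)
      (Ici 0 ×ˢ D ×ˢ univ)) {d : ℝ → Euc l} (hd : InMD D d) {S : Set ℝ} (hS : MeasurableSet S)
    (hS0 : S ⊆ Ici 0) {x : ℝ → Euc n} (hx : ContinuousOn x S) :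
    AEStronglyMeasurable (fun s => f s (d s) (x s)) (volume.restrict S) := by
  classical
  have hx' : Measurable (S.piecewise x (fun _ => 0)) :=
    hx.measurable_piecewise continuousOn_const hS
  have hQ : MeasurableSet ((Ici (0:ℝ)) ×ˢ D ×ˢ (univ : Set (Euc n))) :=
    measurableSet_Ici.prod (hD.measurableSet.prod MeasurableSet.univ)
  have hF := hf_cont.measurable_piecewise (g := fun _ => (0 : Euc n)) continuousOn_const hQ
  have hc := hF.comp (measurable_id.prodMk (hd.1.prodMk hx'))
  refine ⟨_, hc.stronglyMeasurable, ?_⟩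
  filter_upwards [ae_restrict_mem hS] with s hs
  have h1 : (s, d s, x s) ∈ (Ici (0:ℝ)) ×ˢ D ×ˢ (univ : Set (Euc n)) :=
    ⟨hS0 hs, hd.2 s, mem_univ _⟩
  have h2 : S.piecewise x (fun _ => 0) s = x s := by simp [hs]
  simp only [Function.comp, id]
  rw [Set.piecewise_eq_of_mem _ _ _ (by rw [h2]; exact h1), h2]

lemma rhs_bound {n l : ℕ} {D : Set (Euc l)} (hD : IsCompact D)
    {f : ℝ → Euc l → Euc n → Euc n}
    (hf_cont : ContinuousOn (fun p : ℝ × Euc l × Euc n => f p.1 p.2.1 p.2.2)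
      (Ici 0 ×ˢ D ×ˢ univ)) {d : ℝ → Euc l} (hd : InMD D d) {S : Set ℝ} {a b M : ℝ}
    (ha : 0 ≤ a) (hS : S ⊆ Icc a b) {x : ℝ → Euc n} (hx : ∀ s ∈ S, ‖x s‖ ≤ M) :
    ∃ C, 0 ≤ C ∧ ∀ s ∈ S, ‖f s (d s) (x s)‖ ≤ C := by
  have hK : IsCompact (Icc a b ×ˢ D ×ˢ Metric.closedBall (0 : Euc n) M) :=
    isCompact_Icc.prod (hD.prod (isCompact_closedBall _ _))
  obtain ⟨C, hC⟩ := hK.exists_bound_of_continuousOn (hf_cont.mono (by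
    rintro ⟨p, q, r⟩ ⟨h1, h2, h3⟩
    exact ⟨ha.trans h1.1, h2, mem_univ _⟩))
  refine ⟨max C 0, le_max_right _ _, fun s hs => (hC (s, d s, x s) ⟨hS hs, hd.2 s, ?_⟩).trans
    (le_max_left _ _)⟩
  simpa using hx s hs

lemma rhs_int {n l : ℕ} {D : Set (Euc l)} (hD : IsCompact D)
    {f : ℝ → Euc l → Euc n → Euc n}
    (hf_cont : ContinuousOn (fun p : ℝ × Euc l × Euc n => f p.1 p.2.1 p.2.2)
      (Ici 0 ×ˢ D ×ˢ univ)) {d : ℝ → Euc l} (hd : InMD D d) {a b M : ℝ}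
    (ha : 0 ≤ a) (hab : a ≤ b) {x : ℝ → Euc n} (hxc : ContinuousOn x (Ico a b))
    (hx : ∀ s ∈ Ico a b, ‖x s‖ ≤ M) :
    IntervalIntegrable (fun s => f s (d s) (x s)) volume a b := by
  obtain ⟨C, -, hC⟩ := rhs_bound hD hf_cont hd ha Ico_subset_Icc_self hx
  rw [intervalIntegrable_iff_integrableOn_Ico_of_le hab]
  exact Integrable.of_bound
    (rhs_meas hD hf_cont hd measurableSet_Ico (fun s hs => ha.trans hs.1) hxc) C
    ((ae_restrict_mem measurableSet_Ico).mono hC)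

lemma rhs_int' {n l : ℕ} {D : Set (Euc l)} (hD : IsCompact D)
    {f : ℝ → Euc l → Euc n → Euc n}
    (hf_cont : ContinuousOn (fun p : ℝ × Euc l × Euc n => f p.1 p.2.1 p.2.2)
      (Ici 0 ×ˢ D ×ˢ univ)) {d : ℝ → Euc l} (hd : InMD D d) {a b : ℝ}
    (ha : 0 ≤ a) (hab : a ≤ b) {x : ℝ → Euc n} (hxc : ContinuousOn x (Icc a b)) :
    IntervalIntegrable (fun s => f s (d s) (x s)) volume a b := by
  obtain ⟨M, hM⟩ := isCompact_Icc.exists_bound_of_continuousOn hxc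
  exact rhs_int hD hf_cont hd ha hab (hxc.mono Ico_subset_Icc_self)
    (fun s hs => hM s (Ico_subset_Icc_self hs))

lemma deriv_le_of_dini {n : ℕ} {V : ℝ → Euc n → ℝ} {x : ℝ → Euc n} {r e : ℝ} {v : Euc n}
    (hx : HasDerivAt x v r) (hV : DifferentiableAt ℝ (fun s => V s (x s)) r)
    (h : dini0 V r (x r) v ≤ (e : EReal)) : deriv (fun s => V s (x s)) r ≤ e := by
  refine le_of_forall_gt_imp_ge_of_dense fun e' he' => ?_
  have h1 : dini0 V r (x r) v < (e' : EReal) := h.trans_lt (by exact_mod_cast he')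
  have h2 := eventually_lt_of_limsup_lt h1
  have h3 : Tendsto (fun t : ℝ => (t, t⁻¹ • (x (r + t) - x r))) (𝓝[>] 0)
      ((𝓝[>] (0:ℝ)) ×ˢ 𝓝 v) := tendsto_id.prodMk hx.tendsto_slope_zero_right
  have h4 := h3.eventually h2
  refine le_of_tendsto hV.hasDerivAt.tendsto_slope_zero_right ?_
  filter_upwards [h4, self_mem_nhdsWithin] with t ht ht0
  have ht0 : (0:ℝ) < t := ht0
  have h5 : x r + t • (t⁻¹ • (x (r + t) - x r)) = x (r + t) := by
    rw [smul_inv_smul₀ ht0.ne']; abel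
  simp only [h5] at ht
  have := EReal.coe_lt_coe_iff.1 ht
  rw [smul_eq_mul, inv_mul_eq_div]
  exact this.le

lemma decay {n l : ℕ} {D : Set (Euc l)} (hD : IsCompact D)
    {f : ℝ → Euc l → Euc n → Euc n}
    (hf_cont : ContinuousOn (fun p : ℝ × Euc l × Euc n => f p.1 p.2.1 p.2.2)
      (Ici 0 ×ˢ D ×ˢ univ))
    {V : ℝ → Euc n → ℝ} (hVlip : LocallyLipschitz (fun p : ℝ × Euc n => V p.1 p.2))
    {ρ : ℝ → ℝ}
    (hVdecr : ∀ t, 0 ≤ t → ∀ x : Euc n, ∀ d ∈ D,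
      dini0 V t x (f t d x) ≤ ((-ρ (V t x) : ℝ) : EReal))
    {d : ℝ → Euc l} (hd : InMD D d) {t₀ t : ℝ} {x₀ : Euc n} {tm : EReal} {x : ℝ → Euc n}
    (hx : IsSolution f d t₀ x₀ tm x) (h0 : 0 ≤ t₀) (h1 : t₀ ≤ t)
    (ht : (t : EReal) < tm) {c : ℝ} (hc : ∀ r ∈ Icc t₀ t, c ≤ ρ (V r (x r))) :
    V t (x t) - V t₀ (x t₀) ≤ -c * (t - t₀) := by
  obtain ⟨-, -, hxc, hxi⟩ := hx
  have hlt : ∀ r ∈ Icc t₀ t, (r : EReal) < tm := fun r hr =>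
    lt_of_le_of_lt (by exact_mod_cast hr.2) ht
  have hxc : ContinuousOn x (Icc t₀ t) := hxc.mono fun r hr => ⟨hr.1, hlt r hr⟩
  have hint := rhs_int' hD hf_cont hd h0 h1 hxc
  obtain ⟨M, hM⟩ := isCompact_Icc.exists_bound_of_continuousOn hxc
  obtain ⟨C, hC0, hC⟩ := rhs_bound hD hf_cont hd h0 Subset.rfl hM
  have hxl : LipschitzOnWith C.toNNReal x (Icc t₀ t) := by
    refine LipschitzOnWith.of_dist_le_mul fun p hp q hq => ?_
    rw [Real.coe_toNNReal _ hC0, dist_eq_norm, Real.dist_eq, hxi p hp.1 (hlt p hp),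
      hxi q hq.1 (hlt q hq), add_sub_add_left_eq_sub,
      intervalIntegral.integral_interval_sub_left]
    · refine intervalIntegral.norm_integral_le_of_norm_le_const fun s hs => hC s ?_
      exact (uIcc_subset_Icc hq hp) (uIoc_subset_uIcc hs)
    · exact hint.mono_set (by rw [uIcc_of_le h1, uIcc_of_le hp.1]; exact Icc_subset_Icc_right hp.2)
    · exact hint.mono_set (by rw [uIcc_of_le h1, uIcc_of_le hq.1]; exact Icc_subset_Icc_right hq.2)
  have hgl : LipschitzOnWith (max 1 C.toNNReal) (fun s => (s, x s)) (Icc t₀ t) :=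
    (LipschitzWith.id.lipschitzOnWith (s := Icc t₀ t)).prodMk hxl
  have hcomp : IsCompact ((fun s => (s, x s)) '' Icc t₀ t) :=
    isCompact_Icc.image_of_continuousOn hgl.continuousOn
  obtain ⟨K, hK⟩ := (hVlip.locallyLipschitzOn
    (s := (fun s => (s, x s)) '' Icc t₀ t)).exists_lipschitzOnWith_of_compact hcomp
  have hvl := hK.comp hgl (mapsTo_image _ _)
  rw [← uIcc_of_le h1] at hvl
  have hac := hvl.absolutelyContinuousOnInterval
  have hder := hac.ae_differentiableAt
  have hI := hac.integral_deriv_eq_sub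
  have hae := hint.ae_hasDerivAt_integral
  have hne : ∀ᵐ r : ℝ, r ≠ t₀ := by simp [ae_iff, measure_singleton]
  have hne' : ∀ᵐ r : ℝ, r ≠ t := by simp [ae_iff, measure_singleton]
  have key : ∫ r in t₀..t, deriv (fun s => V s (x s)) r ≤ ∫ r in t₀..t, -c := by
    refine intervalIntegral.integral_mono_ae_restrict h1 hac.intervalIntegrable_deriv
      intervalIntegrable_const ?_
    rw [EventuallyLE, ae_restrict_iff' measurableSet_Icc]
    filter_upwards [hder, hae, hne, hne'] with r hr1 hr2 hr3 hr4 hr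
    have hr' : r ∈ uIcc t₀ t := by rwa [uIcc_of_le h1]
    have hd1 := (hr2 hr' t₀ left_mem_uIcc).const_add x₀
    have hd2 : HasDerivAt x (f r (d r) (x r)) r := by
      refine hd1.congr_of_eventuallyEq ?_
      filter_upwards [Icc_mem_nhds (lt_of_le_of_ne hr.1 (Ne.symm hr3))
        (lt_of_le_of_ne hr.2 hr4)] with s hs
      exact hxi s hs.1 (hlt s hs)
    refine deriv_le_of_dini hd2 (hr1 hr') ((hVdecr r (h0.trans hr.1) (x r) (d r) (hd.2 r)).trans ?_)
    exact_mod_cast neg_le_neg (hc r hr)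
  rw [intervalIntegral.integral_const, smul_eq_mul] at key
  have hI' : ∫ r in t₀..t, deriv (fun s => V s (x s)) r = V t (x t) - V t₀ (x t₀) := hI
  rw [← hI']; linarith

lemma decay2 {n l : ℕ} {D : Set (Euc l)} (hD : IsCompact D)
    {f : ℝ → Euc l → Euc n → Euc n}
    (hf_cont : ContinuousOn (fun p : ℝ × Euc l × Euc n => f p.1 p.2.1 p.2.2)
      (Ici 0 ×ˢ D ×ˢ univ))
    {V : ℝ → Euc n → ℝ} (hVlip : LocallyLipschitz (fun p : ℝ × Euc n => V p.1 p.2))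
    {ρ : ℝ → ℝ}
    (hVdecr : ∀ t, 0 ≤ t → ∀ x : Euc n, ∀ d ∈ D,
      dini0 V t x (f t d x) ≤ ((-ρ (V t x) : ℝ) : EReal))
    {d : ℝ → Euc l} (hd : InMD D d) {t₀ s t : ℝ} {x₀ : Euc n} {tm : EReal} {x : ℝ → Euc n}
    (hx : IsSolution f d t₀ x₀ tm x) (h0 : 0 ≤ t₀) (hs : t₀ ≤ s) (h1 : s ≤ t)
    (ht : (t : EReal) < tm) {c : ℝ} (hc : ∀ r ∈ Icc s t, c ≤ ρ (V r (x r))) :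
    V t (x t) - V s (x s) ≤ -c * (t - s) := by
  obtain ⟨-, -, hxc, hxi⟩ := hx
  have hstm : (s : EReal) < tm := lt_of_le_of_lt (by exact_mod_cast h1) ht
  have hint : ∀ a b : ℝ, t₀ ≤ a → a ≤ b → (b : EReal) < tm →
      IntervalIntegrable (fun s => f s (d s) (x s)) volume a b := fun a b ha hab hb =>
    rhs_int' hD hf_cont hd (h0.trans ha) hab (hxc.mono fun r hr =>
      ⟨ha.trans hr.1, lt_of_le_of_lt (by exact_mod_cast hr.2) hb⟩)
  have hsol : IsSolution f d s (x s) tm x := by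
    refine ⟨hstm, rfl, hxc.mono fun r hr => ⟨hs.trans hr.1, hr.2⟩, fun r hr hrt => ?_⟩
    rw [hxi r (hs.trans hr) hrt, hxi s hs hstm, add_assoc,
      intervalIntegral.integral_add_adjacent_intervals (hint t₀ s le_rfl hs hstm)
        (hint s r hs hr hrt)]
  exact decay hD hf_cont hVlip hVdecr hd hsol (h0.trans hs) h1 ht hc

lemma no_escape {n l : ℕ} {D : Set (Euc l)} (hD : IsCompact D)
    {f : ℝ → Euc l → Euc n → Euc n}
    (hf_cont : ContinuousOn (fun p : ℝ × Euc l × Euc n => f p.1 p.2.1 p.2.2)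
      (Ici 0 ×ˢ D ×ˢ univ))
    {X : ℝ → Euc n → (ℝ → Euc l) → ℝ → Euc n}
    {tmax : ℝ → Euc n → (ℝ → Euc l) → EReal}
    (hX : ∀ t₀, 0 ≤ t₀ → ∀ x₀ d, InMD D d →
      IsSolution f d t₀ x₀ (tmax t₀ x₀ d) (X t₀ x₀ d))
    (hXmax : ∀ t₀, 0 ≤ t₀ → ∀ x₀ d, InMD D d → ∀ tm y, IsSolution f d t₀ x₀ tm y →
      tm ≤ tmax t₀ x₀ d ∧ ∀ t : ℝ, t₀ ≤ t → (t : EReal) < tm → y t = X t₀ x₀ d t)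
    {d : ℝ → Euc l} (hd : InMD D d) {t₀ b M : ℝ} {x₀ : Euc n} (h0 : 0 ≤ t₀)
    (hb : tmax t₀ x₀ d = (b : EReal)) (hM : ∀ s ∈ Ico t₀ b, ‖X t₀ x₀ d s‖ ≤ M) : False := by
  obtain ⟨h1, h2, hxc, hxi⟩ := hX t₀ h0 x₀ d hd
  rw [hb] at h1 hxc hxi
  have htb : t₀ < b := by exact_mod_cast h1
  set x := X t₀ x₀ d with hxdef
  have hxc : ContinuousOn x (Ico t₀ b) := hxc.mono fun s hs => ⟨hs.1, by exact_mod_cast hs.2⟩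
  have hint := rhs_int hD hf_cont hd h0 htb.le hxc hM
  set xs : Euc n := x₀ + ∫ s in t₀..b, f s (d s) (x s) with hxs
  obtain ⟨g1, g2, gc, gi⟩ := hX b (h0.trans htb.le) xs d hd
  set z := X b xs d with hz
  set tm := tmax b xs d with htm
  let y : ℝ → Euc n := fun s => if s < b then x s else z s
  have hyx : ∀ s, s < b → y s = x s := fun s hs => if_pos hs
  have hyz : ∀ s, b ≤ s → y s = z s := fun s hs => if_neg hs.not_gt
  have hI1 : ∀ t, t₀ ≤ t → t ≤ b →
      ∫ s in t₀..t, f s (d s) (y s) = ∫ s in t₀..t, f s (d s) (x s) := by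
    intro t ht htb'
    refine intervalIntegral.integral_congr_Ioo_of_le ht fun s hs => ?_
    simp only [hyx s (hs.2.trans_le htb')]
  have hint1 : IntervalIntegrable (fun s => f s (d s) (y s)) volume t₀ b := by
    refine hint.congr_ae ?_
    rw [uIoc_of_le htb.le, EventuallyEq, ae_restrict_iff' measurableSet_Ioc]
    have hne : ∀ᵐ r : ℝ, r ≠ b := by simp [ae_iff, measure_singleton]
    filter_upwards [hne] with s hs hs'
    rw [hyx s (lt_of_le_of_ne hs'.2 hs)]
  have hint2 : ∀ t : ℝ, b ≤ t → (t : EReal) < tm →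
      IntervalIntegrable (fun s => f s (d s) (y s)) volume b t := by
    intro t ht htt
    have hzc : ContinuousOn z (Icc b t) := gc.mono fun s hs =>
      ⟨hs.1, lt_of_le_of_lt (by exact_mod_cast hs.2) htt⟩
    refine rhs_int' hD hf_cont hd (h0.trans htb.le) ht (hzc.congr fun s hs => hyz s hs.1)
  have hI2 : ∀ t, b ≤ t →
      ∫ s in b..t, f s (d s) (y s) = ∫ s in b..t, f s (d s) (z s) := by
    intro t ht
    refine intervalIntegral.integral_congr_Ioo_of_le ht fun s hs => ?_
    simp only [hyz s hs.1.le]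
  have hyi : ∀ t : ℝ, t₀ ≤ t → (t : EReal) < tm → y t = x₀ + ∫ s in t₀..t, f s (d s) (y s) := by
    intro t ht htt
    rcases lt_or_ge t b with h | h
    · rw [hyx t h, hI1 t ht h.le]
      exact hxi t ht (by exact_mod_cast h)
    · rw [hyz t h, ← intervalIntegral.integral_add_adjacent_intervals hint1 (hint2 t h htt),
        hI1 b htb.le le_rfl, hI2 t h, ← add_assoc, ← hxs]
      exact gi t h htt
  have hyc : ContinuousOn y {t : ℝ | t₀ ≤ t ∧ (t : EReal) < tm} := by
    intro t ht
    obtain ⟨t1, ht1, ht1'⟩ : ∃ t1 : ℝ, max t b < t1 ∧ (t1 : EReal) < tm := by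
      obtain ⟨q, hq, hq'⟩ := EReal.lt_iff_exists_real_btwn.1
        (show ((max t b : ℝ) : EReal) < tm by
          rcases max_cases t b with h | h
          · rw [h.1]; exact ht.2
          · rw [h.1]; exact g1)
      exact ⟨q, by exact_mod_cast hq, hq'⟩
    have hbt1 : b < t1 := (le_max_right _ _).trans_lt ht1
    have htt1 : t < t1 := (le_max_left _ _).trans_lt ht1
    have hi := hint1.trans (hint2 t1 hbt1.le ht1')
    have hc := (intervalIntegral.continuousOn_primitive_interval' hi left_mem_uIcc)
    rw [uIcc_of_le (htb.trans hbt1).le] at hc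
    have hc' : ContinuousOn y (Icc t₀ t1) :=
      (continuousOn_const.add hc).congr fun s hs =>
        hyi s hs.1 (lt_of_le_of_lt (by exact_mod_cast hs.2) ht1')
    refine (hc' t ⟨ht.1, htt1.le⟩).mono_of_mem_nhdsWithin ?_
    rw [mem_nhdsWithin]
    exact ⟨Iio t1, isOpen_Iio, htt1, fun s hs => ⟨hs.2.1, hs.1.le⟩⟩
  have hsol : IsSolution f d t₀ x₀ tm y :=
    ⟨h1.trans g1, by rw [hyx t₀ htb]; exact h2, hyc, hyi⟩
  have := (hXmax t₀ h0 x₀ d hd tm y hsol).1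
  rw [hb] at this
  exact absurd g1 this.not_gt

/-- Proposition 2.5 (URGAOS part): under hypothesis (Q2) (i.e. (Q1) with β ≡ 1 and q ≡ 0),
system (2.1) is URGAOS. -/
theorem stmt2 {n l k : ℕ}
    (D : Set (Euc l)) (hD : IsCompact D) (hDne : D.Nonempty)
    (f : ℝ → Euc l → Euc n → Euc n) (H : ℝ → Euc n → Euc k)
    (hf_cont : ContinuousOn (fun p : ℝ × Euc l × Euc n => f p.1 p.2.1 p.2.2)
      (Ici 0 ×ˢ D ×ˢ univ))
    (hf0 : ∀ t, 0 ≤ t → ∀ d ∈ D, f t d 0 = 0)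
    (hH_cont : ContinuousOn (fun p : ℝ × Euc n => H p.1 p.2) (Ici 0 ×ˢ univ))
    (hH0 : ∀ t, 0 ≤ t → H t 0 = 0)
    -- the (assumed unique maximal) solution family of system (2.1)
    (X : ℝ → Euc n → (ℝ → Euc l) → ℝ → Euc n)
    (tmax : ℝ → Euc n → (ℝ → Euc l) → EReal)
    (hX : ∀ t₀, 0 ≤ t₀ → ∀ x₀ d, InMD D d →
      IsSolution f d t₀ x₀ (tmax t₀ x₀ d) (X t₀ x₀ d))
    (hXmax : ∀ t₀, 0 ≤ t₀ → ∀ x₀ d, InMD D d → ∀ tm y, IsSolution f d t₀ x₀ tm y →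
      tm ≤ tmax t₀ x₀ d ∧ ∀ t : ℝ, t₀ ≤ t → (t : EReal) < tm → y t = X t₀ x₀ d t)
    -- hypothesis (Q2): the Lyapunov function with β ≡ 1 and q ≡ 0
    (V : ℝ → Euc n → ℝ) (hVpos : ∀ t x, 0 ≤ V t x)
    (hVlip : LocallyLipschitz (fun p : ℝ × Euc n => V p.1 p.2))
    (a₁ a₂ μ ρ : ℝ → ℝ)
    (ha₁ : IsKinf a₁) (ha₂ : IsKinf a₂) (hμ : IsKplus μ) (hρ : IsPosDef ρ)
    (hVbounds : ∀ t, 0 ≤ t → ∀ x : Euc n,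
      a₁ (pairNorm (μ t • x) (H t x)) ≤ V t x ∧ V t x ≤ a₂ ‖x‖)
    (hVdecr : ∀ t, 0 ≤ t → ∀ x : Euc n, ∀ d ∈ D,
      dini0 V t x (f t d x) ≤ ((-ρ (V t x) : ℝ) : EReal)) :
    -- conclusion: system (2.1) is URGAOS.
    -- Robust Forward Completeness:
    (∀ T, 0 ≤ T → ∀ rr, 0 ≤ rr → ∃ M, ∀ t₀ ∈ Icc (0:ℝ) T, ∀ h ∈ Icc (0:ℝ) T,
      ∀ x₀ : Euc n, ‖x₀‖ ≤ rr → ∀ d, InMD D d →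
        ((t₀ + h : ℝ) : EReal) < tmax t₀ x₀ d ∧ ‖X t₀ x₀ d (t₀ + h)‖ ≤ M) ∧
    -- P1 (Uniform Output Stability):
    (∀ ε, 0 < ε →
      (∃ M, ∀ t₀ : ℝ, 0 ≤ t₀ → ∀ x₀ : Euc n, ‖x₀‖ ≤ ε → ∀ d, InMD D d →
        ∀ t : ℝ, t₀ ≤ t → (t : EReal) < tmax t₀ x₀ d → ‖H t (X t₀ x₀ d t)‖ ≤ M) ∧
      (∃ δ, 0 < δ ∧ ∀ t₀ : ℝ, 0 ≤ t₀ → ∀ x₀ : Euc n, ‖x₀‖ ≤ δ → ∀ d, InMD D d →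
        ∀ t : ℝ, t₀ ≤ t → (t : EReal) < tmax t₀ x₀ d → ‖H t (X t₀ x₀ d t)‖ ≤ ε)) ∧
    -- P2 (Uniform Output Attractivity on compact sets of initial states):
    (∀ ε, 0 < ε → ∀ R, 0 ≤ R → ∃ τ, 0 ≤ τ ∧
      ∀ t₀ : ℝ, 0 ≤ t₀ → ∀ x₀ : Euc n, ‖x₀‖ ≤ R → ∀ d, InMD D d →
        ∀ t : ℝ, t₀ + τ ≤ t → (t : EReal) < tmax t₀ x₀ d → ‖H t (X t₀ x₀ d t)‖ ≤ ε) := by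
  have hsol := hX
  obtain ⟨a1c, a1m, a10, a1t⟩ := ha₁
  obtain ⟨a2c, a2m, a20, a2t⟩ := ha₂
  have pn0 : ∀ (a : Euc n) (b : Euc k), 0 ≤ pairNorm a b := fun a b => Real.sqrt_nonneg _
  have pn1 : ∀ (a : Euc n) (b : Euc k), ‖a‖ ≤ pairNorm a b := fun a b =>
    Real.le_sqrt_of_sq_le (by nlinarith [sq_nonneg ‖b‖])
  have pn2 : ∀ (a : Euc n) (b : Euc k), ‖b‖ ≤ pairNorm a b := fun a b =>
    Real.le_sqrt_of_sq_le (by nlinarith [sq_nonneg ‖a‖])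
  have a2le : ∀ r, ∀ x : Euc n, ‖x‖ ≤ r → a₂ ‖x‖ ≤ a₂ r := fun r x hx =>
    a2m.monotoneOn (norm_nonneg x) ((norm_nonneg x).trans hx) hx
  have mono : ∀ t₀, 0 ≤ t₀ → ∀ x₀ d, InMD D d → ∀ t : ℝ, t₀ ≤ t → (t : EReal) < tmax t₀ x₀ d →
      V t (X t₀ x₀ d t) ≤ a₂ ‖x₀‖ := by
    intro t₀ h0 x₀ d hd t ht htm
    have h := decay hD hf_cont hVlip hVdecr hd (hX t₀ h0 x₀ d hd) h0 ht htm (c := 0)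
      (fun r _ => hρ.2.2.2 _ (hVpos _ _))
    rw [(hX t₀ h0 x₀ d hd).2.1] at h
    have := (hVbounds t₀ h0 x₀).2
    linarith
  have pb : ∀ t, 0 ≤ t → ∀ (x : Euc n) (K : ℝ), 0 ≤ K → V t x ≤ a₁ K →
      pairNorm (μ t • x) (H t x) ≤ K := by
    intro t ht x K hK hV
    by_contra! hlt
    have := a1m hK (pn0 _ _) hlt
    linarith [(hVbounds t ht x).1]
  have exK : ∀ r, ∃ K, 0 ≤ K ∧ a₂ r ≤ a₁ K := fun r =>
    ((eventually_ge_atTop 0).and (a1t.eventually_ge_atTop (a₂ r))).exists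
  have bnd : ∀ B, 0 ≤ B → ∀ rr, ∃ M, ∀ t₀, 0 ≤ t₀ → ∀ x₀ : Euc n, ‖x₀‖ ≤ rr → ∀ d, InMD D d →
      ∀ t : ℝ, t₀ ≤ t → t ≤ B → (t : EReal) < tmax t₀ x₀ d → ‖X t₀ x₀ d t‖ ≤ M := by
    intro B hB rr
    obtain ⟨K, hK0, hK⟩ := exK rr
    obtain ⟨tm, htm, hmin⟩ := (isCompact_Icc (a := (0:ℝ)) (b := B)).exists_isMinOn
      ⟨0, le_rfl, hB⟩ (hμ.1.mono fun s hs => hs.1)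
    have hm : 0 < μ tm := hμ.2 tm htm.1
    refine ⟨K / μ tm, fun t₀ h0 x₀ hx₀ d hd t ht htB htt => ?_⟩
    have h1 := pb t (h0.trans ht) (X t₀ x₀ d t) K hK0
      (((mono t₀ h0 x₀ d hd t ht htt).trans (a2le rr x₀ hx₀)).trans hK)
    have h2 := (pn1 _ _).trans h1
    rw [norm_smul, Real.norm_of_nonneg (hμ.2 t (h0.trans ht)).le] at h2
    have h3 : μ tm ≤ μ t := hmin ⟨h0.trans ht, htB⟩
    rw [le_div_iff₀ hm]
    nlinarith [norm_nonneg (X t₀ x₀ d t)]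
  have complete : ∀ t₀, 0 ≤ t₀ → ∀ x₀ d, InMD D d → tmax t₀ x₀ d = ⊤ := by
    intro t₀ h0 x₀ d hd
    have h1 := (hX t₀ h0 x₀ d hd).1
    induction hq : tmax t₀ x₀ d with
    | bot => rw [hq] at h1; exact absurd h1 not_lt_bot
    | top => rfl
    | coe b =>
      exfalso
      have htb : t₀ < b := by rw [hq] at h1; exact_mod_cast h1
      obtain ⟨M, hM⟩ := bnd b (h0.trans htb.le) ‖x₀‖
      exact no_escape hD hf_cont hX hXmax hd h0 hq fun s hs =>
        hM t₀ h0 x₀ le_rfl d hd s hs.1 hs.2.le (by rw [hq]; exact_mod_cast hs.2)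
  refine ⟨?_, ?_, ?_⟩
  · intro T hT rr hrr
    obtain ⟨M, hM⟩ := bnd (T + T) (by linarith) rr
    refine ⟨M, fun t₀ ht₀ h hh x₀ hx₀ d hd => ?_⟩
    have hlt : ((t₀ + h : ℝ) : EReal) < tmax t₀ x₀ d := by
      rw [complete t₀ ht₀.1 x₀ d hd]; exact EReal.coe_lt_top _
    exact ⟨hlt, hM t₀ ht₀.1 x₀ hx₀ d hd _ (by linarith [hh.1]) (by linarith [hh.2, ht₀.2]) hlt⟩
  · intro ε hε
    have out : ∀ r K, 0 ≤ K → a₂ r ≤ a₁ K → ∀ t₀ : ℝ, 0 ≤ t₀ → ∀ x₀ : Euc n, ‖x₀‖ ≤ r →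
        ∀ d, InMD D d → ∀ t : ℝ, t₀ ≤ t → (t : EReal) < tmax t₀ x₀ d →
        ‖H t (X t₀ x₀ d t)‖ ≤ K := fun r K hK0 hK t₀ h0 x₀ hx₀ d hd t ht htt =>
      (pn2 _ _).trans (pb t (h0.trans ht) (X t₀ x₀ d t) K hK0
        (((mono t₀ h0 x₀ d hd t ht htt).trans (a2le r x₀ hx₀)).trans hK))
    constructor
    · obtain ⟨K, hK0, hK⟩ := exK ε
      exact ⟨K, out ε K hK0 hK⟩
    · have hpos : 0 < a₁ ε := by
        rw [← a10]; exact a1m (mem_Ici.2 le_rfl) (mem_Ici.2 hε.le) hε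
      have hc : Tendsto a₂ (𝓝[>] 0) (𝓝 (a₂ 0)) :=
        (a2c 0 (mem_Ici.2 le_rfl)).mono_left (nhdsWithin_mono _ Ioi_subset_Ici_self)
      rw [a20] at hc
      obtain ⟨δ, hδ, hδ0⟩ := ((hc.eventually_le_const hpos).and self_mem_nhdsWithin).exists
      exact ⟨δ, hδ0, out δ ε hε.le hδ⟩
  · intro ε hε R hR
    have hpos : 0 < a₁ ε := by
      rw [← a10]; exact a1m (mem_Ici.2 le_rfl) (mem_Ici.2 hε.le) hε
    obtain ⟨c, hc0, hc⟩ : ∃ c, 0 < c ∧ ∀ s ∈ Icc (a₁ ε) (a₂ R), c ≤ ρ s := by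
      rcases (Icc (a₁ ε) (a₂ R)).eq_empty_or_nonempty with h | h
      · exact ⟨1, one_pos, by simp [h]⟩
      · obtain ⟨s, hs, hmin⟩ := isCompact_Icc.exists_isMinOn h
          (hρ.1.mono fun s hs => hpos.le.trans hs.1)
        exact ⟨ρ s, hρ.2.2.1 s (hpos.trans_le hs.1), fun r hr => hmin hr⟩
    have ha2R : 0 ≤ a₂ R := by
      rw [← a20]; exact a2m.monotoneOn (mem_Ici.2 le_rfl) (mem_Ici.2 hR) hR
    refine ⟨a₂ R / c, by positivity, fun t₀ h0 x₀ hx₀ d hd t ht htt => ?_⟩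
    have htt0 : t₀ ≤ t := by
      have : 0 ≤ a₂ R / c := by positivity
      linarith
    refine (pn2 _ _).trans (pb t (h0.trans htt0) (X t₀ x₀ d t) ε hε.le ?_)
    by_contra! hlt
    have hs := hX t₀ h0 x₀ d hd
    have hup : ∀ r, t₀ ≤ r → r ≤ t → V r (X t₀ x₀ d r) ≤ a₂ R := fun r hr hrt =>
      (mono t₀ h0 x₀ d hd r hr (lt_of_le_of_lt (by exact_mod_cast hrt) htt)).trans
        (a2le R x₀ hx₀)
    have hlow : ∀ r, t₀ ≤ r → r ≤ t → a₁ ε ≤ V r (X t₀ x₀ d r) := by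
      intro r hr hrt
      have hrm : (r : EReal) < tmax t₀ x₀ d := lt_of_le_of_lt (by exact_mod_cast hrt) htt
      have h := decay2 hD hf_cont hVlip hVdecr hd hs h0 hr hrt htt (c := 0)
        (fun r _ => hρ.2.2.2 _ (hVpos _ _))
      linarith
    have h := decay hD hf_cont hVlip hVdecr hd hs h0 htt0 htt (c := c)
      (fun r hr => hc _ ⟨hlow r hr.1 hr.2, hup r hr.1 hr.2⟩)
    have h1 := hup t₀ le_rfl htt0
    have h2 : a₂ R ≤ c * (t - t₀) := by
      have : a₂ R / c ≤ t - t₀ := by linarith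
      rw [div_le_iff₀ hc0] at this
      linarith
    linarith
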